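/- arXiv:math/0610357 — 11 statements merged into one kernel-verified Lean document; each statement's English description precedes it below -/
import Mathlib

section
/- For every nonempty topological space X, the Grzegorczyk formula □(□(p → □p) → p) → □p (for a fixed propositional letter p) is valid in X if and only if X is hereditarily irresolvable. -/
/-- Formulas of the basic modal language. -/
inductive ModalFormula : Type
  | top : ModalFormula
  | prop : ℕ → ModalFormula
  | and : ModalFormula → ModalFormula → ModalFormula
  | neg : ModalFormula → ModalFormula
  | box : ModalFormula → ModalFormula

namespace ModalFormula

/-- Truth of a modal formula at a point of a topological model. -/
def Holds {X : Type*} [TopologicalSpace X] (ν : ℕ → Set X) : ModalFormula → X → Prop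
  | .top, _ => True
  | .prop n, w => w ∈ ν n
  | .and φ ψ, w => Holds ν φ w ∧ Holds ν ψ w
  | .neg φ, w => ¬ Holds ν φ w
  | .box φ, w => ∃ O : Set X, IsOpen O ∧ w ∈ O ∧ ∀ v ∈ O, Holds ν φ v

/-- Validity of a modal formula in a topological space. -/
def Valid (X : Type*) [TopologicalSpace X] (φ : ModalFormula) : Prop :=
  ∀ (ν : ℕ → Set X) (w : X), Holds ν φ w

/-- Material implication, as an abbreviation. -/
def impl (φ ψ : ModalFormula) : ModalFormula := .neg (.and φ (.neg ψ))

end ModalFormula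

/-- A space is hereditarily irresolvable if no nonempty subset can be split into two
disjoint subsets both dense in it. -/
def HereditarilyIrresolvable (X : Type*) [TopologicalSpace X] : Prop :=
  ¬ ∃ S B B' : Set X, S.Nonempty ∧ B ∪ B' = S ∧ Disjoint B B' ∧
      S ⊆ closure B ∧ S ⊆ closure B'

/-- The Grzegorczyk formula □(□(p → □p) → p) → □p for the propositional letter p = p₀. -/
def grzFormula : ModalFormula :=
  ModalFormula.impl
    (ModalFormula.box
      (ModalFormula.impl
        (ModalFormula.box
          (ModalFormula.impl (ModalFormula.prop 0) (ModalFormula.box (ModalFormula.prop 0))))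
        (ModalFormula.prop 0)))
    (ModalFormula.box (ModalFormula.prop 0))

namespace ModalFormula

variable {X : Type*} [TopologicalSpace X] {ν : ℕ → Set X} {φ ψ : ModalFormula} {w : X}

theorem holds_prop {n : ℕ} : Holds ν (prop n) w ↔ w ∈ ν n := Iff.rfl

theorem holds_impl : Holds ν (impl φ ψ) w ↔ (Holds ν φ w → Holds ν ψ w) := by
  simp only [impl, Holds, not_and, not_not]

theorem holds_box : Holds ν (box φ) w ↔ w ∈ interior {v | Holds ν φ v} := by
  simp only [Holds, mem_interior, Set.subset_def, Set.mem_ofPred_eq]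
  exact exists_congr fun O => by tauto

end ModalFormula

open ModalFormula in
/-- The Grzegorczyk formula expressed with the interior operator. -/
theorem valid_grzFormula_iff (X : Type*) [TopologicalSpace X] :
    Valid X grzFormula ↔ ∀ A : Set X,
      interior {x | x ∈ interior {v | v ∈ A → v ∈ interior A} → x ∈ A} ⊆ interior A := by
  simp only [Valid, grzFormula, holds_impl, holds_box, holds_prop, Set.ofPred_mem_eq]
  exact ⟨fun h A w => h (fun _ => A) w, fun h ν w => @h (ν 0) w⟩

theorem statement0 (X : Type*) [TopologicalSpace X] [Nonempty X] :
    ModalFormula.Valid X grzFormula ↔ HereditarilyIrresolvable X := by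
  rw [valid_grzFormula_iff]
  constructor
  · rintro h ⟨S, B, B', ⟨s, hs⟩, rfl, hdisj, hB, hB'⟩
    have premise : {x | x ∈ interior {v | v ∈ Bᶜ → v ∈ interior Bᶜ} → x ∈ Bᶜ} = Set.univ := by
      refine Set.eq_univ_of_forall fun x hx hxB => ?_
      obtain ⟨v, hv, hvB'⟩ := mem_closure_iff.1 (hB' (Or.inl hxB)) _ isOpen_interior hx
      have hvint := interior_subset hv (hdisj.notMem_of_mem_right hvB')
      rw [interior_compl] at hvint
      exact hvint (hB (Or.inr hvB'))
    have hsint := h Bᶜ (by rw [premise, interior_univ]; exact Set.mem_univ s)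
    rw [interior_compl] at hsint
    exact hsint (hB hs)
  · intro hirr A w hw
    by_contra hwA
    set U := interior {x | x ∈ interior {v | v ∈ A → v ∈ interior A} → x ∈ A}
    have hUo : IsOpen U := isOpen_interior
    refine hirr ⟨_, U ∩ Aᶜ, U ∩ (A \ interior A), ⟨w, ?_⟩, rfl, ?_, ?_, ?_⟩
    · by_cases hA : w ∈ A
      · exact Or.inr ⟨hw, hA, hwA⟩
      · exact Or.inl ⟨hw, hA⟩
    · exact Set.disjoint_left.2 fun x hx hx' => hx.2 hx'.2.1
    · refine Set.union_subset subset_closure fun x hx => hUo.inter_closure ⟨hx.1, ?_⟩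
      rw [closure_compl]
      exact hx.2.2
    · refine Set.union_subset (fun x hx => hUo.inter_closure ⟨hx.1, ?_⟩) subset_closure
      have hnot : x ∉ interior {v | v ∈ A → v ∈ interior A} :=
        fun hx' => hx.2 (interior_subset hx.1 hx')
      rw [← Set.mem_compl_iff, ← closure_compl] at hnot
      exact closure_mono (fun v hv => by simpa using hv) hnot
end

section
/- A topological space X is hereditarily irresolvable if and only if for every subset A ⊆ X, closure A ⊆ closure (A \ closure (closure A \ A)). -/
theorem statement1 (X : Type*) [TopologicalSpace X] :
    HereditarilyIrresolvable X ↔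
      ∀ A : Set X, closure A ⊆ closure (A \ closure (closure A \ A)) := by
  constructor
  · intro h A
    refine closure_minimal (fun x hx => ?_) isClosed_closure
    by_contra hx'
    obtain ⟨U, hU, hxU, hdisj⟩ : ∃ U, IsOpen U ∧ x ∈ U ∧
        ∀ y ∈ U, y ∉ A \ closure (closure A \ A) := by
      simpa [mem_closure_iff, Set.not_nonempty_iff_eq_empty, Set.eq_empty_iff_forall_notMem]
        using hx'
    refine h ⟨U ∩ closure A, U ∩ A, U ∩ (closure A \ A), ⟨x, hxU, subset_closure hx⟩,
      ?_, ?_, hU.inter_closure, ?_⟩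
    · rw [← Set.inter_union_distrib_left, Set.union_sdiff_cancel subset_closure]
    · exact Set.disjoint_sdiff_right.mono Set.inter_subset_right Set.inter_subset_right
    · rintro y ⟨hyU, hyA⟩
      by_cases hy : y ∈ A
      · exact hU.inter_closure ⟨hyU, not_not.mp fun hn => hdisj y hyU ⟨hy, hn⟩⟩
      · exact subset_closure ⟨hyU, hyA, hy⟩
  · rintro h ⟨S, B, B', ⟨x, hx⟩, rfl, hdisj, hB, hB'⟩
    have hsub : B' ⊆ closure B \ B :=
      Set.subset_sdiff.mpr ⟨Set.subset_union_right.trans hB, hdisj.symm⟩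
    have hempty : B \ closure (closure B \ B) = ∅ :=
      Set.sdiff_eq_empty.mpr
        ((Set.subset_union_left.trans hB').trans (closure_mono hsub))
    simpa [hempty] using h B (hB hx)
end

section
/- Let X and Y be topological spaces and f : X → Y a surjective interior map (continuous and open). For every modal formula φ, if φ is valid in X then φ is valid in Y. -/
/-- Truth is invariant under interior maps, for the pulled-back valuation. -/
theorem ModalFormula.holds_preimage_iff {X Y : Type*} [TopologicalSpace X] [TopologicalSpace Y]
    {f : X → Y} (hcont : Continuous f) (hopen : IsOpenMap f) (ν : ℕ → Set Y)
    (φ : ModalFormula) (x : X) :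
    Holds (fun n => f ⁻¹' ν n) φ x ↔ Holds ν φ (f x) := by
  induction φ generalizing x with
  | top => exact Iff.rfl
  | prop n => exact Iff.rfl
  | and φ ψ ihφ ihψ => exact and_congr (ihφ x) (ihψ x)
  | neg φ ih => exact not_congr (ih x)
  | box φ ih =>
    constructor
    · rintro ⟨O, hO, hx, h⟩
      refine ⟨f '' O, hopen O hO, Set.mem_image_of_mem f hx, ?_⟩
      rintro _ ⟨v, hv, rfl⟩
      exact (ih v).1 (h v hv)
    · rintro ⟨O, hO, hx, h⟩
      exact ⟨f ⁻¹' O, hO.preimage hcont, hx, fun v hv => (ih v).2 (h (f v) hv)⟩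

theorem statement6 {X Y : Type*} [TopologicalSpace X] [TopologicalSpace Y]
    (f : X → Y) (hsurj : Function.Surjective f) (hcont : Continuous f)
    (hopen : IsOpenMap f) (φ : ModalFormula) :
    ModalFormula.Valid X φ → ModalFormula.Valid Y φ := by
  intro h ν y
  obtain ⟨x, rfl⟩ := hsurj y
  exact (ModalFormula.holds_preimage_iff hcont hopen ν φ x).1 (h _ x)
end

section
/- For every topological space X, the Alexandroff extension X* is Alexandrov-discrete: every intersection of open sets of X* is open; equivalently, every point of X* has a least open neighborhood. -/
/-- A filter is open if it is closed under taking interiors. -/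
def IsOpenFilter {X : Type*} [TopologicalSpace X] (F : Filter X) : Prop :=
  ∀ A ∈ F, interior A ∈ F

/-- The Alexandroff extension of a topological space: the set of ultrafilters on X with the
topology generated by the sets of ultrafilters extending a fixed open filter. -/
def alexandroffTopology (X : Type*) [TopologicalSpace X] : TopologicalSpace (Ultrafilter X) :=
  TopologicalSpace.generateFrom
    {O : Set (Ultrafilter X) |
      ∃ F : Filter X, IsOpenFilter F ∧ O = {u : Ultrafilter X | (u : Filter X) ≤ F}}


open Topology

/-- The filter generated by the open members of a filter. -/
def openCore {X : Type*} [TopologicalSpace X] (F : Filter X) : Filter X where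
  sets := {A | interior A ∈ F}
  univ_sets := by simp
  sets_of_superset hA hAB := Filter.mem_of_superset hA (interior_mono hAB)
  inter_sets hA hB := by
    simpa only [Set.mem_ofPred_eq, interior_inter] using Filter.inter_mem hA hB

theorem mem_openCore {X : Type*} [TopologicalSpace X] {F : Filter X} {A : Set X} :
    A ∈ openCore F ↔ interior A ∈ F :=
  Iff.rfl

theorem isOpenFilter_openCore {X : Type*} [TopologicalSpace X] (F : Filter X) :
    IsOpenFilter (openCore F) := fun A hA => by
  rwa [mem_openCore, interior_interior]

theorem le_openCore {X : Type*} [TopologicalSpace X] (F : Filter X) : F ≤ openCore F :=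
  fun _ hA => Filter.mem_of_superset hA interior_subset

theorem IsOpenFilter.openCore_le {X : Type*} [TopologicalSpace X] {F G : Filter X}
    (hG : IsOpenFilter G) (h : F ≤ G) : openCore F ≤ G :=
  fun A hA => h (hG A hA)

/-- The ultrafilters extending `openCore u` lie in every open neighborhood of `u`. -/
theorem mem_of_isOpen_of_le_openCore {X : Type*} [TopologicalSpace X]
    {O : Set (Ultrafilter X)} (hO : IsOpen[alexandroffTopology X] O) {u v : Ultrafilter X}
    (hu : u ∈ O) (hv : (v : Filter X) ≤ openCore u) : v ∈ O := by
  induction hO with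
  | basic s hs =>
    obtain ⟨F, hF, rfl⟩ := hs
    exact hv.trans (hF.openCore_le hu)
  | univ => trivial
  | inter s t _ _ ihs iht => exact ⟨ihs hu.1, iht hu.2⟩
  | sUnion S _ ih =>
    obtain ⟨s, hs, hus⟩ := hu
    exact ⟨s, hs, ih s hs hus⟩

theorem statement7 (X : Type*) [TopologicalSpace X] :
    @AlexandrovDiscrete (Ultrafilter X) (alexandroffTopology X) := by
  let := alexandroffTopology X
  refine ⟨fun S hS => isOpen_iff_forall_mem_open.2 fun u hu => ?_⟩
  refine ⟨{v : Ultrafilter X | (v : Filter X) ≤ openCore u}, fun v hv s hs => ?_,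
    .basic _ ⟨_, isOpenFilter_openCore _, rfl⟩, le_openCore _⟩
  exact mem_of_isOpen_of_le_openCore (hS s hs) (hu s hs) hv
end

section
/- Let X be a topological space and X* its Alexandroff extension. For every modal formula φ, if φ is valid in X* then φ is valid in X. -/
/-- The infimum of two open filters is open. -/
theorem IsOpenFilter.inf {X : Type*} [TopologicalSpace X] {F G : Filter X}
    (hF : IsOpenFilter F) (hG : IsOpenFilter G) : IsOpenFilter (F ⊓ G) := by
  intro A hA
  obtain ⟨B, hB, C, hC, rfl⟩ := Filter.mem_inf_iff.1 hA
  rw [interior_inter]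
  exact Filter.inter_mem_inf (hF B hB) (hG C hC)

/-- The principal filter of an open set is open. -/
theorem isOpenFilter_principal {X : Type*} [TopologicalSpace X] {U : Set X} (hU : IsOpen U) :
    IsOpenFilter (Filter.principal U) := fun _ hA =>
  Filter.mem_principal.2 (interior_maximal (Filter.mem_principal.1 hA) hU)

/-- The sets of ultrafilters extending an open filter form a basis of the Alexandroff
extension. -/
theorem exists_isOpenFilter_of_isOpen_alexandroffTopology {X : Type*} [TopologicalSpace X]
    {O : Set (Ultrafilter X)} (hO : @IsOpen _ (alexandroffTopology X) O) {u : Ultrafilter X}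
    (hu : u ∈ O) :
    ∃ F : Filter X, IsOpenFilter F ∧ (u : Filter X) ≤ F ∧
      ∀ v : Ultrafilter X, (v : Filter X) ≤ F → v ∈ O := by
  change TopologicalSpace.GenerateOpen _ O at hO
  induction hO with
  | basic s hs =>
    obtain ⟨F, hF, rfl⟩ := hs
    exact ⟨F, hF, hu, fun _ hv => hv⟩
  | univ => exact ⟨⊤, fun A hA => by simp_all, le_top, fun _ _ => trivial⟩
  | inter s t _ _ ihs iht =>
    obtain ⟨F, hF, huF, hFs⟩ := ihs hu.1
    obtain ⟨G, hG, huG, hGt⟩ := iht hu.2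
    exact ⟨F ⊓ G, hF.inf hG, le_inf huF huG, fun v hv =>
      ⟨hFs v (hv.trans inf_le_left), hGt v (hv.trans inf_le_right)⟩⟩
  | sUnion S _ ih =>
    obtain ⟨s, hs, hus⟩ := hu
    obtain ⟨F, hF, huF, hFs⟩ := ih s hs hus
    exact ⟨F, hF, huF, fun v hv => ⟨s, hs, hFs v hv⟩⟩

/-- The box of a formula is true exactly on the interior of its truth set. -/
theorem ModalFormula.setOf_holds_box {X : Type*} [TopologicalSpace X] (ν : ℕ → Set X)
    (φ : ModalFormula) : {w | Holds ν (.box φ) w} = interior {w | Holds ν φ w} := by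
  ext w
  simp only [Holds, Set.mem_ofPred_eq, mem_interior]
  exact exists_congr fun O => ⟨fun ⟨hO, hw, h⟩ => ⟨h, hO, hw⟩, fun ⟨h, hO, hw⟩ => ⟨hO, hw, h⟩⟩

/-- Truth lemma: a formula is true at an ultrafilter iff its truth set belongs to it. -/
theorem ModalFormula.holds_alexandroffTopology_iff {X : Type*} [TopologicalSpace X]
    (ν : ℕ → Set X) (φ : ModalFormula) (u : Ultrafilter X) :
    @Holds (Ultrafilter X) (alexandroffTopology X) (fun n => {v | ν n ∈ v}) φ u ↔
      {w | Holds ν φ w} ∈ u := by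
  induction φ generalizing u with
  | top => exact iff_of_true trivial Filter.univ_mem
  | prop n => rfl
  | and φ ψ ihφ ihψ =>
    simp only [Holds, ihφ, ihψ]
    exact Filter.inter_mem_iff.symm
  | neg φ ih =>
    simp only [Holds, ih]
    exact Ultrafilter.compl_mem_iff_notMem.symm
  | box φ ih =>
    rw [setOf_holds_box]
    simp only [Holds, ih]
    constructor
    · rintro ⟨O, hO, hu, h⟩
      obtain ⟨F, hF, huF, hFO⟩ := exists_isOpenFilter_of_isOpen_alexandroffTopology hO hu
      exact huF (hF _ (Filter.mem_iff_ultrafilter.2 fun v hv => h v (hFO v hv)))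
    · intro hu
      refine ⟨_, TopologicalSpace.isOpen_generateFrom_of_mem
        ⟨_, isOpenFilter_principal isOpen_interior, rfl⟩, Filter.le_principal_iff.2 hu, ?_⟩
      intro v hv
      exact Filter.mem_of_superset (Filter.le_principal_iff.1 hv) interior_subset

theorem statement8 (X : Type*) [TopologicalSpace X] (φ : ModalFormula) :
    @ModalFormula.Valid (Ultrafilter X) (alexandroffTopology X) φ →
      ModalFormula.Valid X φ := by
  intro h ν w
  exact (ModalFormula.holds_alexandroffTopology_iff ν φ (pure w)).1 (h _ _)
end

section
/- The class of disconnected (nonempty) topological spaces is not modally definable: there is no set Γ of modal formulas such that for every nonempty topological space X, X validates all formulas of Γ iff X is not connected. -/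
/-- A class of (nonempty) topological spaces is modally definable if there is a set of
modal formulas whose validity characterizes membership in the class, among all nonempty
topological spaces. -/
def ModallyDefinable (K : (X : Type) → TopologicalSpace X → Prop) : Prop :=
  ∃ Γ : Set ModalFormula, ∀ (X : Type) (t : TopologicalSpace X), Nonempty X →
    (K X t ↔ ∀ φ ∈ Γ, @ModalFormula.Valid X t φ)


namespace ModalFormula

/-- Truth is preserved and reflected by continuous open maps, for pulled-back valuations. -/
theorem holds_preimage_iff_s10 {X Y : Type*} [TopologicalSpace X] [TopologicalSpace Y] {f : X → Y}
    (hf : Continuous f) (hfo : IsOpenMap f) (ν : ℕ → Set Y) (φ : ModalFormula) (w : X) :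
    Holds (fun n => f ⁻¹' ν n) φ w ↔ Holds ν φ (f w) := by
  induction φ generalizing w with
  | top => exact Iff.rfl
  | prop n => exact Iff.rfl
  | and φ ψ ihφ ihψ => exact and_congr (ihφ w) (ihψ w)
  | neg φ ih => exact not_congr (ih w)
  | box φ ih =>
    constructor
    · rintro ⟨O, hO, hw, h⟩
      refine ⟨f '' O, hfo O hO, Set.mem_image_of_mem f hw, ?_⟩
      rintro _ ⟨v, hv, rfl⟩
      exact (ih v).1 (h v hv)
    · rintro ⟨O, hO, hw, h⟩
      exact ⟨f ⁻¹' O, hO.preimage hf, hw, fun v hv => (ih v).2 (h (f v) hv)⟩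

/-- Validity is preserved under images of continuous open surjections. -/
theorem Valid.of_surjective {X Y : Type*} [TopologicalSpace X] [TopologicalSpace Y] {f : X → Y}
    (hf : Continuous f) (hfo : IsOpenMap f) (hfs : Function.Surjective f) {φ : ModalFormula}
    (h : Valid X φ) : Valid Y φ := by
  intro ν y
  obtain ⟨x, rfl⟩ := hfs y
  exact (holds_preimage_iff_s10 hf hfo ν φ x).1 (h _ x)

end ModalFormula

theorem not_connectedSpace_bool : ¬ ConnectedSpace Bool := by
  intro h
  have := PreconnectedSpace.trivial_of_discrete (X := Bool)
  exact not_subsingleton Bool this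

theorem statement10 :
    ¬ ModallyDefinable (fun X t => ¬ @ConnectedSpace X t) := by
  rintro ⟨Γ, hΓ⟩
  have hBool := (hΓ Bool inferInstance inferInstance).1 not_connectedSpace_bool
  refine (hΓ Unit inferInstance inferInstance).2 (fun φ hφ => ?_) inferInstance
  exact (hBool φ hφ).of_surjective (f := fun _ => ()) continuous_const
    (fun _ _ => isOpen_discrete _) (fun _ => ⟨true, rfl⟩)
end

section
/- The class of Alexandrov-discrete (nonempty) topological spaces is not modally definable: there is no set Γ of modal formulas such that for every nonempty topological space X, X validates all formulas of Γ iff X is Alexandrov-discrete (arbitrary intersections of opens are open). -/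
open scoped Topology

namespace ModalFormula

/-- For each formula there are finitely many open sets such that every coarser topology in which
they remain open evaluates the formula in the same way. -/
theorem exists_finite_opens_holds_iff {X : Type*} (t : TopologicalSpace X) (ν : ℕ → Set X)
    (φ : ModalFormula) :
    ∃ S : Set (Set X), S.Finite ∧ (∀ s ∈ S, IsOpen[t] s) ∧
      ∀ t' : TopologicalSpace X, t ≤ t' → (∀ s ∈ S, IsOpen[t'] s) →
        ∀ w, @Holds X t' ν φ w ↔ @Holds X t ν φ w := by
  induction φ with
  | top => exact ⟨∅, Set.finite_empty, by simp, fun _ _ _ _ => Iff.rfl⟩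
  | prop n => exact ⟨∅, Set.finite_empty, by simp, fun _ _ _ _ => Iff.rfl⟩
  | and φ ψ hφ hψ =>
    obtain ⟨S, hS, hSo, hS'⟩ := hφ
    obtain ⟨T, hT, hTo, hT'⟩ := hψ
    refine ⟨S ∪ T, hS.union hT, fun s hs => hs.elim (hSo s) (hTo s), fun t' ht h w => ?_⟩
    exact and_congr (hS' t' ht (fun s hs => h s (Or.inl hs)) w)
      (hT' t' ht (fun s hs => h s (Or.inr hs)) w)
  | neg φ hφ =>
    obtain ⟨S, hS, hSo, hS'⟩ := hφ
    exact ⟨S, hS, hSo, fun t' ht h w => not_congr (hS' t' ht h w)⟩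
  | box φ hφ =>
    obtain ⟨S, hS, hSo, hS'⟩ := hφ
    have hint : IsOpen[t] {w | @Holds X t ν φ.box w} := by
      refine isOpen_iff_forall_mem_open.2 fun w hw => ?_
      obtain ⟨O, hO, hwO, hOφ⟩ := hw
      exact ⟨O, fun v hv => ⟨O, hO, hv, hOφ⟩, hO, hwO⟩
    refine ⟨insert {w | @Holds X t ν φ.box w} S, hS.insert _, ?_, fun t' ht h w => ?_⟩
    · rintro s (rfl | hs)
      exacts [hint, hSo s hs]
    · have hφ := hS' t' ht fun s hs => h s (Or.inr hs)
      constructor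
      · rintro ⟨O, hO, hwO, hOφ⟩
        exact ⟨O, ht O hO, hwO, fun v hv => (hφ v).1 (hOφ v hv)⟩
      · intro hw
        refine ⟨{w | @Holds X t ν φ.box w}, h _ (Or.inl rfl), hw, ?_⟩
        rintro v ⟨O, -, hvO, hOφ⟩
        exact (hφ v).2 (hOφ v hvO)

end ModalFormula

/-- Any finite family of open sets is open in some coarser Alexandrov-discrete topology. -/
theorem exists_alexandrovDiscrete_ge {X : Type*} (t : TopologicalSpace X) {S : Set (Set X)}
    (hS : S.Finite) (hSo : ∀ s ∈ S, IsOpen[t] s) :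
    ∃ t' : TopologicalSpace X, t ≤ t' ∧ (∀ s ∈ S, IsOpen[t'] s) ∧ @AlexandrovDiscrete X t' := by
  let t' : TopologicalSpace X :=
    { IsOpen := fun U => ∀ x ∈ U, ∀ y, (∀ s ∈ S, x ∈ s → y ∈ s) → y ∈ U
      isOpen_univ := fun _ _ _ _ => trivial
      isOpen_inter := fun U V hU hV x hx y hy => ⟨hU x hx.1 y hy, hV x hx.2 y hy⟩
      isOpen_sUnion := fun 𝒰 h x ⟨U, hU, hx⟩ y hy => ⟨U, hU, h U hU x hx y hy⟩ }
  refine ⟨t', fun U hU => ?_, fun s hs x hx y hy => hy s hs hx, ?_⟩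
  · refine (@isOpen_iff_forall_mem_open X t U).2 fun x hx => ⟨⋂₀ {s ∈ S | x ∈ s}, ?_, ?_, ?_⟩
    · exact fun y hy => hU x hx y fun s hs hxs => hy s ⟨hs, hxs⟩
    · exact @Set.Finite.isOpen_sInter X t _ (hS.subset (Set.sep_subset _ _)) fun s hs => hSo s hs.1
    · exact fun s hs => hs.2
  · exact @AlexandrovDiscrete.mk X t' fun 𝒰 h x hx y hy U hU => h U hU x (hx U hU) y hy

theorem not_alexandrovDiscrete_real : ¬ AlexandrovDiscrete ℝ := by
  intro h
  have hopen : IsOpen (⋂₀ {U : Set ℝ | IsOpen U ∧ 0 ∈ U}) := isOpen_sInter fun U hU => hU.1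
  have hzero : ⋂₀ {U : Set ℝ | IsOpen U ∧ 0 ∈ U} = {0} := by
    refine Set.Subset.antisymm (fun x hx => ?_) (Set.singleton_subset_iff.2 fun U hU => hU.2)
    by_contra hne
    exact hx {x}ᶜ ⟨isOpen_compl_singleton, fun h0 => hne (Eq.symm h0)⟩ rfl
  exact not_isOpen_singleton (0 : ℝ) (hzero ▸ hopen)

theorem statement12 :
    ¬ ModallyDefinable (fun X t => @AlexandrovDiscrete X t) := by
  rintro ⟨Γ, hΓ⟩
  refine not_alexandrovDiscrete_real ((hΓ ℝ inferInstance inferInstance).2 fun φ hφ ν w => ?_)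
  obtain ⟨S, hS, hSo, hiff⟩ := φ.exists_finite_opens_holds_iff inferInstance ν
  obtain ⟨t', ht, hSt', halex⟩ := exists_alexandrovDiscrete_ge _ hS hSo
  exact (hiff t' ht hSt' w).1 ((hΓ ℝ t' inferInstance).1 halex φ hφ ν w)
end

section
/- For every topological space X there exist an index set I, an ultrafilter D on I, and a surjective map f from the topological ultrapower of X over D onto the Alexandroff extension X* that is both continuous and open. -/
/-- The equivalence relation of agreement on a D-large set of indices. -/
def ultraSetoid {I : Type*} (D : Ultrafilter I) (X : I → Type*) : Setoid (∀ i, X i) where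
  r a b := {i | a i = b i} ∈ D
  iseqv := by
    refine ⟨fun a => ?_, fun {a b} h => ?_, fun {a b c} h₁ h₂ => ?_⟩
    · have : {i | a i = a i} = Set.univ := by simp
      rw [this]; exact Filter.univ_mem
    · exact Filter.mem_of_superset h fun i hi => (hi : a i = b i).symm
    · exact Filter.mem_of_superset (Filter.inter_mem h₁ h₂)
        fun i hi => (hi.1 : a i = b i).trans hi.2

/-- The topological ultraproduct of a family of topological spaces over an ultrafilter:
the quotient of the product by D-a.e. agreement, with the topology generated by the
ultraboxes determined by families of open sets. -/
def ultraTopology {I : Type*} (D : Ultrafilter I) (X : I → Type*)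
    [∀ i, TopologicalSpace (X i)] : TopologicalSpace (Quotient (ultraSetoid D X)) :=
  TopologicalSpace.generateFrom
    {U : Set (Quotient (ultraSetoid D X)) | ∃ O : ∀ i, Set (X i), (∀ i, IsOpen (O i)) ∧
      U = Quotient.mk (ultraSetoid D X) '' {a | {i | a i ∈ O i} ∈ D}}

universe u

open Filter Set
open Cardinal hiding univ

/-- The ultrafilter-like dichotomy behind good ultrafilters: either `φ` takes a value whose
complement is large, or `φ` has a multiplicative refinement given by `σ`. -/
def Decides {I K : Type*} (F : Filter I) (φ : Finset K → Set I) : Prop :=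
  (∃ s, (φ s)ᶜ ∈ F) ∨ ∃ σ : I → Finset K, ∀ k, ∀ᶠ i in F, k ∈ σ i ∧ i ∈ φ (σ i)

theorem Decides.mono {I K : Type*} {F F' : Filter I} {φ : Finset K → Set I} (h : F' ≤ F)
    (hF : Decides F φ) : Decides F' φ :=
  hF.imp (fun ⟨s, hs⟩ => ⟨s, h hs⟩) fun ⟨σ, hσ⟩ => ⟨σ, fun k => h (hσ k)⟩

/-- The functions `g A`, for `A` outside `R`, are independent modulo the filter `F`. -/
def IndepMod {I J V : Type*} (g : J → I → V) (F : Filter I) (R : Set J) : Prop :=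
  ∀ t : Finset J, (∀ A ∈ t, A ∉ R) → ∀ v : J → V, ∃ᶠ i in F, ∀ A ∈ t, g A i = v A

theorem IndepMod.exists_decides {I J K : Type*} {g : J → I → Finset K} {F : Filter I} {R : Set J}
    (h : IndepMod g F R) (hR : ∃ A, A ∉ R) (φ : Finset K → Set I) :
    ∃ p : Filter I × Finset J, p.1 ≤ F ∧ IndepMod g p.1 (R ∪ p.2) ∧ Decides p.1 φ := by
  classical
  by_cases hφ : ∀ s, IndepMod g (F ⊓ 𝓟 (φ s)) R
  · obtain ⟨A₀, hA₀⟩ := hR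
    let C : Finset K → Set I := fun s => {i | s ⊆ g A₀ i ∧ i ∈ φ (g A₀ i)}
    refine ⟨⟨⨅ s, F ⊓ 𝓟 (C s), {A₀}⟩, (iInf_le _ ∅).trans inf_le_left, ?_, Or.inr ⟨g A₀, ?_⟩⟩
    · intro t ht v hev
      have hdir : Directed (· ≥ ·) fun s => F ⊓ 𝓟 (C s) := by
        intro s s'
        refine ⟨s ∪ s', inf_le_inf_left _ (principal_mono.2 ?_),
          inf_le_inf_left _ (principal_mono.2 ?_)⟩
        · exact fun i hi => ⟨Finset.subset_union_left.trans hi.1, hi.2⟩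
        · exact fun i hi => ⟨Finset.subset_union_right.trans hi.1, hi.2⟩
      obtain ⟨s, hs⟩ := (mem_iInf_of_directed hdir _).1 hev
      rw [mem_inf_principal] at hs
      have hfr := hφ s (insert A₀ t) (by
        intro A hA
        rcases Finset.mem_insert.1 hA with rfl | hA
        · exact hA₀
        · exact fun hAR => ht A hA (Or.inl hAR)) (fun A => if A = A₀ then s else v A)
      rw [frequently_inf_principal] at hfr
      refine hfr ?_
      filter_upwards [hs] with i hi hi'
      have h₀ : g A₀ i = s := by simpa using hi'.2 A₀ (Finset.mem_insert_self _ _)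
      refine hi ⟨h₀ ▸ subset_rfl, h₀ ▸ hi'.1⟩ fun A hA => ?_
      have hne : A ≠ A₀ := by
        rintro rfl
        exact ht A hA (Or.inr (by simp))
      simpa [hne] using hi'.2 A (Finset.mem_insert_of_mem hA)
    · intro k
      refine iInf_le (fun s => F ⊓ 𝓟 (C s)) {k} ?_
      refine mem_inf_of_right ?_
      exact fun i hi => ⟨by simpa using hi.1, hi.2⟩
  · simp only [IndepMod, not_forall, exists_prop] at hφ
    obtain ⟨s, t, ht, v, hv⟩ := hφ
    rw [frequently_inf_principal, not_frequently] at hv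
    refine ⟨⟨F ⊓ 𝓟 {i | ∀ A ∈ t, g A i = v A}, t⟩, inf_le_left, ?_, Or.inl ⟨s, ?_⟩⟩
    · intro t' ht' v'
      rw [frequently_inf_principal]
      refine (h (t ∪ t') ?_ (fun A => if A ∈ t then v A else v' A)).mono ?_
      · intro A hA
        rcases Finset.mem_union.1 hA with hA | hA
        · exact ht A hA
        · exact fun hAR => ht' A hA (Or.inl hAR)
      · intro i hi
        refine ⟨fun A hA => by simpa [hA] using hi A (Finset.mem_union_left _ hA), fun A hA => ?_⟩
        have hAt : A ∉ t := fun hAt => ht' A hA (Or.inr hAt)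
        simpa [hAt] using hi A (Finset.mem_union_right _ hA)
    · rw [mem_inf_principal]
      filter_upwards [hv] with i hi hi' hi''
      exact hi ⟨hi'', hi'⟩

theorem IndepMod.biInf {I J V T : Type*} {g : J → I → V} {F : T → Filter I} {R : T → Set J}
    {R' : Set J} {S : Set T} (hdir : DirectedOn (F ⁻¹'o (· ≥ ·)) S)
    (h₀ : IndepMod g ⊤ ∅) (h : ∀ s ∈ S, IndepMod g (F s) (R s)) (hR : ∀ s ∈ S, R s ⊆ R') :
    IndepMod g (⨅ s ∈ S, F s) R' := by
  intro t ht v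
  rcases S.eq_empty_or_nonempty with rfl | hS
  · simpa using h₀ t (fun _ _ => notMem_empty _) v
  · intro hev
    obtain ⟨s, hs, hev⟩ := (mem_biInf_of_directed hdir hS).1 hev
    exact h s hs t (fun A hA hAR => ht A hA (hR s hs hAR)) v hev

theorem exists_notMem_biUnion_finset {T J : Type u} {S : Set T} (ρ : T → Finset J)
    (hJ : ℵ₀ < #J) (hS : #S < #J) : ∃ A, A ∉ ⋃ s ∈ S, (ρ s : Set J) := by
  by_contra! hall
  have huniv : ⋃ s : S, (ρ s : Set J) = univ := by
    rw [← biUnion_eq_iUnion S fun s _ => (ρ s : Set J)]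
    exact eq_univ_of_forall hall
  have hle : #J ≤ #S * ℵ₀ := by
    calc #J = #(⋃ s : S, (ρ s : Set J)) := by rw [huniv, mk_univ]
      _ ≤ Cardinal.sum fun s : S => #(ρ s : Set J) := mk_iUnion_le_sum_mk
      _ ≤ Cardinal.sum fun _ : S => ℵ₀ :=
          Cardinal.sum_le_sum _ _ fun s => (Cardinal.lt_aleph0_of_finite _).le
      _ = #S * ℵ₀ := by simp
  exact (hle.trans_lt (mul_lt_of_lt hJ.le hS hJ)).false

/-- Transfinite construction of a filter deciding every `φ`. -/
theorem IndepMod.exists_forall_decides {I J K : Type u} {g : J → I → Finset K}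
    (h₀ : IndepMod g ⊤ ∅) (hJ : ℵ₀ < #J) (hT : #(Finset K → Set I) ≤ #J) :
    ∃ F : Filter I, F.NeBot ∧ ∀ φ : Finset K → Set I, Decides F φ := by
  classical
  obtain ⟨r, hr, hord⟩ := Cardinal.exists_ord_eq (Finset K → Set I)
  have hstep : ∀ (φ : Finset K → Set I) (F : Filter I) (R : Set J),
      ∃ p : Filter I × Finset J, IndepMod g F R → (∃ A, A ∉ R) →
        p.1 ≤ F ∧ IndepMod g p.1 (R ∪ p.2) ∧ Decides p.1 φ := by
    intro φ F R
    by_cases h : IndepMod g F R ∧ ∃ A, A ∉ R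
    · obtain ⟨p, hp⟩ := h.1.exists_decides h.2 φ
      exact ⟨p, fun _ _ => hp⟩
    · exact ⟨⟨⊤, ∅⟩, fun h₁ h₂ => absurd ⟨h₁, h₂⟩ h⟩
  choose step hstep using hstep
  let H : (Finset K → Set I) → Filter I × Finset J := hr.wf.fix fun t H =>
    step t (⨅ s, ⨅ h : r s t, (H s h).1) (⋃ s, ⋃ h : r s t, ((H s h).2 : Set J))
  have hH : ∀ t, H t = step t (⨅ s ∈ {s | r s t}, (H s).1)
      (⋃ s ∈ {s | r s t}, ((H s).2 : Set J)) := fun t => hr.wf.fix_eq _ t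
  let Q : (Finset K → Set I) → Set J := fun t => (⋃ s ∈ {s | r s t}, ((H s).2 : Set J)) ∪ (H t).2
  have key : ∀ t, (H t).1 ≤ (⨅ s ∈ {s | r s t}, (H s).1) ∧ IndepMod g (H t).1 (Q t) ∧
      Decides (H t).1 t := by
    intro t
    induction t using hr.wf.induction with
    | _ t ih =>
    have hind : IndepMod g (⨅ s ∈ {s | r s t}, (H s).1)
        (⋃ s ∈ {s | r s t}, ((H s).2 : Set J)) := by
      refine IndepMod.biInf ?_ h₀ (fun s hs => (ih s hs).2.1) ?_
      · intro s hs s' hs'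
        rcases trichotomous_of r s s' with h | rfl | h
        · exact ⟨s', hs', (ih s' hs').1.trans (iInf₂_le s h), le_rfl⟩
        · exact ⟨s, hs, le_rfl, le_rfl⟩
        · exact ⟨s, hs, le_rfl, (ih s hs).1.trans (iInf₂_le s' h)⟩
      · intro s hs
        refine union_subset (iUnion₂_subset fun s' hs' => ?_) ?_
        · exact subset_biUnion_of_mem (u := fun s => ((H s).2 : Set J))
            (show s' ∈ {s | r s t} from _root_.trans hs' hs)
        · exact subset_biUnion_of_mem (u := fun s => ((H s).2 : Set J)) hs
    have hcard : #{s | r s t} < #J := (Cardinal.card_typein_lt t hord).trans_le hT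
    have := hstep t _ _ hind (exists_notMem_biUnion_finset (fun s => (H s).2) hJ hcard)
    rw [← hH] at this
    exact this
  have hfin : IndepMod g (⨅ s ∈ (univ : Set (Finset K → Set I)), (H s).1) univ := by
    refine IndepMod.biInf ?_ h₀ (fun s _ => (key s).2.1) fun _ _ => subset_univ _
    intro s hs s' hs'
    rcases trichotomous_of r s s' with h | rfl | h
    · exact ⟨s', hs', (key s').1.trans (iInf₂_le s h), le_rfl⟩
    · exact ⟨s, hs, le_rfl, le_rfl⟩
    · exact ⟨s, hs, le_rfl, (key s).1.trans (iInf₂_le s' h)⟩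
  refine ⟨⨅ s ∈ univ, (H s).1, ?_,
    fun φ => (key φ).2.2.mono (iInf₂_le (f := fun s _ => (H s).1) φ (mem_univ φ))⟩
  exact ⟨fun h => hfin ∅ (by simp) (fun _ => ∅) (h ▸ eventually_bot)⟩

/-- A large independent family of functions on a set of the size of `K`. -/
theorem exists_indepMod (K : Type u) [Infinite K] :
    ∃ (I : Type u) (g : Set K → I → Finset K), #I = #K ∧ IndepMod g ⊤ ∅ := by
  classical
  refine ⟨Finset K × Finset (Finset K × Finset K), fun A i =>
    if h : ∃ v, (i.1.filter (· ∈ A), v) ∈ i.2 then h.choose else ∅, ?_, ?_⟩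
  · simp [mul_eq_self (aleph0_le_mk K)]
  · intro t _ v
    rw [frequently_top]
    have hsep : ∀ A B : Set K, ∃ x : K, A ≠ B → ¬(x ∈ A ↔ x ∈ B) := by
      intro A B
      by_cases h : A = B
      · exact ⟨Classical.arbitrary K, fun h' => absurd h h'⟩
      · rw [Set.ext_iff, not_forall] at h
        exact h.imp fun x hx _ => hx
    choose x hx using hsep
    let s : Finset K := (t ×ˢ t).image fun p => x p.1 p.2
    have hinj : ∀ A ∈ t, ∀ B ∈ t, s.filter (· ∈ A) = s.filter (· ∈ B) → A = B := by
      intro A hA B hB hAB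
      by_contra hne
      have hxs : x A B ∈ s :=
        Finset.mem_image.2 ⟨(A, B), Finset.mem_product.2 ⟨hA, hB⟩, rfl⟩
      refine hx A B hne ?_
      have := Finset.ext_iff.1 hAB (x A B)
      simpa [hxs] using this
    refine ⟨(s, t.image fun A => (s.filter (· ∈ A), v A)), fun A hA => ?_⟩
    have hex : ∃ w, (s.filter (· ∈ A), w) ∈ t.image fun A => (s.filter (· ∈ A), v A) :=
      ⟨v A, Finset.mem_image_of_mem _ hA⟩
    refine (dif_pos hex).trans ?_
    obtain ⟨B, hB, hBe⟩ := Finset.mem_image.1 hex.choose_spec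
    obtain ⟨h₁, h₂⟩ := Prod.mk.inj hBe
    rw [← h₂, hinj B hB A hA h₁]

theorem exists_ultrafilter_decides_of_infinite (K : Type u) [Infinite K] :
    ∃ (I : Type u) (D : Ultrafilter I), ∀ φ : Finset K → Set I, Decides (D : Filter I) φ := by
  obtain ⟨I, g, hI, hg⟩ := exists_indepMod K
  have hJ : ℵ₀ < #(Set K) := by
    rw [mk_set]
    exact (aleph0_le_mk K).trans_lt (cantor _)
  have hT : #(Finset K → Set I) ≤ #(Set K) := by
    simp [hI, ← power_mul, mul_eq_self (aleph0_le_mk K)]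
  obtain ⟨F, hF, hdec⟩ := hg.exists_forall_decides hJ hT
  exact ⟨I, Ultrafilter.of F, fun φ => (hdec φ).mono (Ultrafilter.of_le F)⟩

theorem exists_ultrafilter_decides (K : Type u) :
    ∃ (I : Type u) (D : Ultrafilter I), ∀ φ : Finset K → Set I, Decides (D : Filter I) φ := by
  classical
  obtain ⟨I, D, hD⟩ := exists_ultrafilter_decides_of_infinite (K ⊕ ULift.{u} ℕ)
  refine ⟨I, D, fun φ => ?_⟩
  rcases hD (fun s => φ s.toLeft) with ⟨s, hs⟩ | ⟨σ, hσ⟩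
  · exact Or.inl ⟨_, hs⟩
  · refine Or.inr ⟨fun i => (σ i).toLeft, fun k => (hσ (Sum.inl k)).mono fun i hi => ?_⟩
    exact ⟨Finset.mem_toLeft.2 hi.1, hi.2⟩

theorem exists_map_eq_of_decides {I X : Type*} {D : Ultrafilter I}
    (hD : ∀ φ : Finset (Set X) → Set I, Decides (D : Filter I) φ) (O : I → Set X)
    (v : Ultrafilter X) (h : ∀ A ∈ v, ∀ᶠ i in D, (O i ∩ A).Nonempty) :
    ∃ b : I → X, (∀ᶠ i in D, b i ∈ O i) ∧ D.map b = v := by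
  classical
  have hX : Nonempty X := (v : Filter X).nonempty_of_neBot
  let P : Finset (Set X) → Set X := fun s => ⋂ A ∈ s.filter (· ∈ v), A
  have hP : ∀ s, P s ∈ v := fun s =>
    (biInter_finset_mem (f := (v : Filter X)) _).2 fun A hA => (Finset.mem_filter.1 hA).2
  rcases hD fun s => {i | (O i ∩ P s).Nonempty} with ⟨s, hs⟩ | ⟨σ, hσ⟩
  · obtain ⟨i, hi, hi'⟩ := (D : Filter I).nonempty_of_mem (inter_mem hs (h _ (hP s)))
    exact absurd hi' hi
  · have hb : ∀ i, ∃ x, (O i ∩ P (σ i)).Nonempty → x ∈ O i ∩ P (σ i) := fun i => by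
      by_cases hi : (O i ∩ P (σ i)).Nonempty
      · exact hi.imp fun x hx _ => hx
      · exact ⟨Classical.arbitrary X, fun h' => absurd h' hi⟩
    choose b hb using hb
    refine ⟨b, (hσ univ).mono fun i hi => (hb i hi.2).1, ?_⟩
    refine Ultrafilter.coe_le_coe.1 fun A hA => ?_
    refine (hσ A).mono fun i hi => ?_
    exact mem_iInter₂.1 (hb i hi.2).2 A (Finset.mem_filter.2 ⟨hi.1, hA⟩)

theorem exists_finset_eventually_mem_of_decides {I K : Type*} {D : Ultrafilter I}
    (hD : ∀ φ : Finset K → Set I, Decides (D : Filter I) φ) :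
    ∃ σ : I → Finset K, ∀ k, ∀ᶠ i in D, k ∈ σ i := by
  rcases hD fun _ => univ with ⟨s, hs⟩ | ⟨σ, hσ⟩
  · simp at hs
  · exact ⟨σ, fun k => (hσ k).mono fun i hi => hi.1⟩

section Ultraproduct

variable {I : Type*} (D : Ultrafilter I)

/-- The ultrabox determined by a family of sets. -/
def ultrabox {X : I → Type*} (O : ∀ i, Set (X i)) : Set (Quotient (ultraSetoid D X)) :=
  Quotient.mk (ultraSetoid D X) '' {a | {i | a i ∈ O i} ∈ D}

theorem mk_mem_ultrabox {X : I → Type*} {O : ∀ i, Set (X i)} {a : ∀ i, X i} :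
    Quotient.mk (ultraSetoid D X) a ∈ ultrabox D O ↔ ∀ᶠ i in D, a i ∈ O i := by
  refine ⟨?_, fun h => ⟨a, h, rfl⟩⟩
  rintro ⟨b, hb, hab⟩
  filter_upwards [hb, Quotient.exact hab] with i hi hi'
  exact (show b i = a i from hi') ▸ hi

theorem isTopologicalBasis_ultrabox (X : I → Type*) [∀ i, TopologicalSpace (X i)] :
    @TopologicalSpace.IsTopologicalBasis _ (ultraTopology D X)
      {U | ∃ O : ∀ i, Set (X i), (∀ i, IsOpen (O i)) ∧ U = ultrabox D O} := by
  let := ultraTopology D X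
  refine ⟨?_, ?_, rfl⟩
  · rintro _ ⟨O, hO, rfl⟩ _ ⟨O', hO', rfl⟩ q hq
    refine ⟨_, ⟨fun i => O i ∩ O' i, fun i => (hO i).inter (hO' i), rfl⟩, ?_, ?_⟩
    · induction q using Quotient.inductionOn with | _ a =>
      exact (mk_mem_ultrabox D).2 (((mk_mem_ultrabox D).1 hq.1).and ((mk_mem_ultrabox D).1 hq.2))
    · intro q' hq'
      induction q' using Quotient.inductionOn with | _ a =>
      have := (mk_mem_ultrabox D).1 hq'
      exact ⟨(mk_mem_ultrabox D).2 (this.mono fun i hi => hi.1),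
        (mk_mem_ultrabox D).2 (this.mono fun i hi => hi.2)⟩
  · refine eq_univ_of_forall fun q => ⟨_, ⟨fun _ => univ, fun _ => isOpen_univ, rfl⟩, ?_⟩
    induction q using Quotient.inductionOn with | _ a =>
    exact (mk_mem_ultrabox D).2 (by simp)

/-- The map sending the class of `a` to the image of the ultrafilter under `a`. -/
def ultraMap (X : Type*) : Quotient (ultraSetoid D fun _ : I => X) → Ultrafilter X :=
  Quotient.lift (fun a => D.map a) fun a b h =>
    Ultrafilter.coe_injective (Filter.map_congr (show a =ᶠ[D] b from h))

/-- The filter of sets containing almost every member of the family `O`. -/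
def boxFilter {X : Type*} (O : I → Set X) : Filter X where
  sets := {A | ∀ᶠ i in D, O i ⊆ A}
  univ_sets := by simp
  sets_of_superset h hAB := h.mono fun _ hi => hi.trans hAB
  inter_sets h h' := (h.and h').mono fun _ hi => subset_inter hi.1 hi.2

theorem isOpenFilter_boxFilter {X : Type*} [TopologicalSpace X] {O : I → Set X}
    (hO : ∀ i, IsOpen (O i)) : IsOpenFilter (boxFilter D O) := by
  intro A hA
  change ∀ᶠ i in D, O i ⊆ interior A
  exact Eventually.mono hA fun i hi => interior_maximal hi (hO i)

variable {D}

theorem ultraMap_image_ultrabox {X : Type*}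
    (hD : ∀ φ : Finset (Set X) → Set I, Decides (D : Filter I) φ) (O : I → Set X) :
    ultraMap D X '' ultrabox D O = {v : Ultrafilter X | (v : Filter X) ≤ boxFilter D O} := by
  ext v
  constructor
  · rintro ⟨_, ⟨b, hb, rfl⟩, rfl⟩ A hA
    have hA' : ∀ᶠ i in D, O i ⊆ A := hA
    change ∀ᶠ i in D, b i ∈ A
    filter_upwards [hb, hA'] with i hi hi'
    exact hi' hi
  · intro hv
    obtain ⟨b, hb, rfl⟩ := exists_map_eq_of_decides hD O v fun A hA => by
      by_contra hne
      have hc : Aᶜ ∈ boxFilter D O := by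
        refine (Ultrafilter.eventually_not.2 hne).mono fun i hi => ?_
        rw [not_nonempty_iff_eq_empty] at hi
        exact (disjoint_iff_inter_eq_empty.2 hi).subset_compl_right
      exact Ultrafilter.compl_mem_iff_notMem.1 (hv hc) hA
    exact ⟨_, ⟨b, hb, rfl⟩, rfl⟩

theorem ultraMap_surjective {X : Type*}
    (hD : ∀ φ : Finset (Set X) → Set I, Decides (D : Filter I) φ) :
    Function.Surjective (ultraMap D X) := by
  intro v
  obtain ⟨b, -, hb⟩ := exists_map_eq_of_decides hD (fun _ => univ) v fun A hA => by
    simpa using (v : Filter X).nonempty_of_mem hA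
  exact ⟨Quotient.mk _ b, hb⟩

theorem isOpenMap_ultraMap {X : Type*} [TopologicalSpace X]
    (hD : ∀ φ : Finset (Set X) → Set I, Decides (D : Filter I) φ) :
    @IsOpenMap _ _ (ultraTopology D fun _ : I => X) (alexandroffTopology X) (ultraMap D X) := by
  let := ultraTopology D fun _ : I => X
  let := alexandroffTopology X
  rw [(isTopologicalBasis_ultrabox D fun _ : I => X).isOpenMap_iff]
  rintro _ ⟨O, hO, rfl⟩
  rw [ultraMap_image_ultrabox hD]
  exact TopologicalSpace.isOpen_generateFrom_of_mem ⟨_, isOpenFilter_boxFilter D hO, rfl⟩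

theorem continuous_ultraMap {X : Type*} [TopologicalSpace X]
    (hD : ∀ φ : Finset (Set X) → Set I, Decides (D : Filter I) φ) :
    @Continuous _ _ (ultraTopology D fun _ : I => X) (alexandroffTopology X) (ultraMap D X) := by
  classical
  let := ultraTopology D fun _ : I => X
  obtain ⟨σ, hσ⟩ := exists_finset_eventually_mem_of_decides hD
  refine continuous_generateFrom_iff.2 ?_
  rintro _ ⟨F, hF, rfl⟩
  rw [(isTopologicalBasis_ultrabox D fun _ : I => X).isOpen_iff]
  intro q hq
  induction q using Quotient.inductionOn with | _ a =>
  let S : I → Finset (Set X) := fun i => (σ i).filter fun A => A ∈ F ∧ a i ∈ interior A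
  refine ⟨_, ⟨fun i => ⋂ A ∈ S i, interior A,
    fun i => isOpen_biInter_finset fun A _ => isOpen_interior, rfl⟩, ?_, ?_⟩
  · exact (mk_mem_ultrabox D).2 (Eventually.of_forall fun i =>
      mem_iInter₂.2 fun A hA => (Finset.mem_filter.1 hA).2.2)
  · rintro _ ⟨b, hb, rfl⟩ A hA
    have ha : ∀ᶠ i in D, a i ∈ interior A := hq (hF A hA)
    change ∀ᶠ i in D, b i ∈ A
    filter_upwards [hb, hσ A, ha] with i hi hiσ hia
    exact interior_subset (mem_iInter₂.1 hi A (Finset.mem_filter.2 ⟨hiσ, hA, hia⟩))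

end Ultraproduct

theorem statement13 (X : Type u) [TopologicalSpace X] :
    ∃ (I : Type u) (D : Ultrafilter I)
      (f : Quotient (ultraSetoid D (fun _ : I => X)) → Ultrafilter X),
      Function.Surjective f ∧
      @Continuous _ _ (ultraTopology D (fun _ : I => X)) (alexandroffTopology X) f ∧
      @IsOpenMap _ _ (ultraTopology D (fun _ : I => X)) (alexandroffTopology X) f := by
  obtain ⟨I, D, hD⟩ := exists_ultrafilter_decides (Set X)
  exact ⟨I, D, ultraMap D X, ultraMap_surjective hD, continuous_ultraMap hD,
    isOpenMap_ultraMap hD⟩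
end

section
/- Let X be the set ℕ equipped with the topology whose open sets are exactly ∅, ℕ, and the initial segments {m : m < n} for n ∈ ℕ. Then the Alexandroff extension X* of X is not hereditarily irresolvable; hence the class of hereditarily irresolvable spaces is not closed under Alexandroff extensions. -/
/-- If the only open set belonging to `u` is the whole space, then the only neighbourhood of `u`
in the Alexandroff extension is the whole extension. -/
theorem eq_univ_of_isOpen_alexandroffTopology {X : Type*} [TopologicalSpace X]
    {u : Ultrafilter X} (hu : ∀ U : Set X, IsOpen U → U ∈ u → U = Set.univ)
    {O : Set (Ultrafilter X)} (hO : @IsOpen _ (alexandroffTopology X) O) (huO : u ∈ O) :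
    O = Set.univ := by
  change TopologicalSpace.GenerateOpen _ O at hO
  induction hO with
  | basic s hs =>
    obtain ⟨F, hF, rfl⟩ := hs
    refine Set.eq_univ_of_forall fun v A hA => ?_
    have hint : interior A = Set.univ := hu _ isOpen_interior (huO (hF A hA))
    rw [interior_eq_univ.mp hint]
    exact Filter.univ_mem
  | univ => rfl
  | inter s t _ _ ihs iht => rw [ihs huO.1, iht huO.2, Set.univ_inter]
  | sUnion S _ ih =>
    obtain ⟨s, hs, hus⟩ := huO
    exact Set.eq_univ_of_univ_subset (ih s hs hus ▸ Set.subset_sUnion_of_mem hs)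

/-- Two distinct ultrafilters, neither of which contains a proper open set, form a resolvable
subspace of the Alexandroff extension. -/
theorem not_hereditarilyIrresolvable_of_ne {X : Type*} [TopologicalSpace X]
    {u v : Ultrafilter X} (huv : u ≠ v)
    (hu : ∀ U : Set X, IsOpen U → U ∈ u → U = Set.univ)
    (hv : ∀ U : Set X, IsOpen U → U ∈ v → U = Set.univ) :
    ¬ @HereditarilyIrresolvable (Ultrafilter X) (alexandroffTopology X) := by
  let := alexandroffTopology X
  have key : ∀ w ∈ ({u} ∪ {v} : Set (Ultrafilter X)), ∀ x, w ∈ closure {x} := by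
    intro w hw x
    refine mem_closure_iff.mpr fun O hO hwO => ⟨x, ?_, rfl⟩
    have hOu : O = Set.univ := by
      rcases hw with rfl | rfl
      · exact eq_univ_of_isOpen_alexandroffTopology hu hO hwO
      · exact eq_univ_of_isOpen_alexandroffTopology hv hO hwO
    exact hOu ▸ Set.mem_univ x
  exact fun hHI => hHI ⟨{u} ∪ {v}, {u}, {v}, ⟨u, Or.inl rfl⟩, rfl,
    Set.disjoint_singleton.mpr huv, fun w hw => key w hw u, fun w hw => key w hw v⟩

theorem statement16 (t : TopologicalSpace ℕ)
    (h : ∀ O : Set ℕ, @IsOpen ℕ t O ↔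
      (O = ∅ ∨ O = Set.univ ∨ ∃ n : ℕ, O = {m | m < n})) :
    ¬ @HereditarilyIrresolvable (Ultrafilter ℕ) (@alexandroffTopology ℕ t) := by
  have free : ∀ f : ℕ → ℕ, f.Injective → ∀ U : Set ℕ, IsOpen U →
      U ∈ (Filter.hyperfilter ℕ).map f → U = Set.univ := by
    intro f hf U hU hmem
    rcases (h U).mp hU with rfl | rfl | ⟨n, rfl⟩
    · exact (Ultrafilter.empty_notMem hmem).elim
    · rfl
    · exact absurd hmem (Filter.notMem_hyperfilter_of_finite
        ((Set.finite_lt_nat n).preimage hf.injOn))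
  refine not_hereditarilyIrresolvable_of_ne
    (u := (Filter.hyperfilter ℕ).map fun n => 2 * n)
    (v := (Filter.hyperfilter ℕ).map fun n => 2 * n + 1) (fun heq => ?_)
    (free _ fun a b hab => by grind) (free _ fun a b hab => by grind)
  have heven : {n : ℕ | Even n} ∈ (Filter.hyperfilter ℕ).map fun n => 2 * n :=
    Ultrafilter.mem_map.mpr (Filter.univ_mem' fun n => even_two_mul n)
  rw [heq, Ultrafilter.mem_map] at heven
  refine Ultrafilter.empty_notMem (f := Filter.hyperfilter ℕ) ?_
  convert heven using 1
  ext n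
  simp
end

section
/- Let X be the set ℕ equipped with the cofinite topology (open sets are ∅ and the complements of finite sets). Then a nonempty set O of ultrafilters on ℕ is open in the Alexandroff extension X* if and only if O contains every free (non-principal) ultrafilter on ℕ. -/
open Filter Topology

theorem Ultrafilter.le_cofinite_iff_forall_finite_notMem {X : Type*} {u : Ultrafilter X} :
    (u : Filter X) ≤ cofinite ↔ ∀ s : Set X, s.Finite → s ∉ u := by
  simp only [le_cofinite_iff_compl_singleton_mem, Ultrafilter.mem_coe,
    Ultrafilter.compl_mem_iff_notMem]
  refine ⟨fun h s hs hsu => ?_, fun h x => h _ (Set.finite_singleton x)⟩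
  obtain ⟨x, -, hx⟩ := Ultrafilter.eq_pure_of_finite_mem hs hsu
  exact h x (hx ▸ Ultrafilter.mem_pure.2 rfl)

section Cofinite

variable {X : Type*} [TopologicalSpace X]

/-- In a cofinite topology, proper open filters consist of cofinite sets. -/
theorem IsOpenFilter.cofinite_le (ht : ∀ O : Set X, IsOpen O ↔ O = ∅ ∨ Oᶜ.Finite)
    {F : Filter X} [F.NeBot] (hF : IsOpenFilter F) : cofinite ≤ F := by
  intro A hA
  have hne : interior A ≠ ∅ := (nonempty_of_mem (hF A hA)).ne_empty
  have hfin := ((ht _).1 isOpen_interior).resolve_left hne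
  exact mem_cofinite.2 (hfin.subset (Set.compl_subset_compl.2 interior_subset))

/-- In a cofinite topology, filters consisting of cofinite sets are open. -/
theorem isOpenFilter_of_cofinite_le (ht : ∀ O : Set X, IsOpen O ↔ O = ∅ ∨ Oᶜ.Finite)
    {F : Filter X} (hF : cofinite ≤ F) : IsOpenFilter F := by
  intro A hA
  rwa [((ht A).2 (Or.inr (hF hA))).interior_eq]

theorem isOpen_alexandroffTopology_iff_of_cofinite
    (ht : ∀ O : Set X, IsOpen O ↔ O = ∅ ∨ Oᶜ.Finite)
    {O : Set (Ultrafilter X)} (hO : O.Nonempty) :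
    IsOpen[alexandroffTopology X] O ↔
      ∀ u : Ultrafilter X, (u : Filter X) ≤ cofinite → u ∈ O := by
  constructor
  · intro h
    change TopologicalSpace.GenerateOpen _ O at h
    intro u hu
    induction h with
    | basic s hs =>
      obtain ⟨F, hF, rfl⟩ := hs
      obtain ⟨v, hv⟩ := hO
      have : F.NeBot := v.neBot.mono hv
      exact hu.trans (hF.cofinite_le ht)
    | univ => trivial
    | inter s t _ _ hs ht => exact ⟨hs hO.left, ht hO.right⟩
    | sUnion S _ ih =>
      obtain ⟨v, s, hs, hv⟩ := hO
      exact ⟨s, hs, ih s hs ⟨v, hv⟩⟩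
  · intro h
    let _ := alexandroffTopology X
    have hcover : O = ⋃ u ∈ O, {v : Ultrafilter X | (v : Filter X) ≤ ↑u ⊔ cofinite} := by
      ext v
      simp only [Set.mem_iUnion, Set.mem_ofPred_eq, Ultrafilter.le_sup_iff, Ultrafilter.coe_le_coe]
      refine ⟨fun hv => ⟨v, hv, Or.inl rfl⟩, ?_⟩
      rintro ⟨u, hu, rfl | hv⟩
      exacts [hu, h v hv]
    rw [hcover]
    exact isOpen_biUnion fun u _ => TopologicalSpace.isOpen_generateFrom_of_mem
      ⟨_, isOpenFilter_of_cofinite_le ht le_sup_right, rfl⟩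

end Cofinite

theorem statement17 (t : TopologicalSpace ℕ)
    (ht : ∀ O : Set ℕ, @IsOpen ℕ t O ↔ (O = ∅ ∨ Oᶜ.Finite))
    (O : Set (Ultrafilter ℕ)) (hO : O.Nonempty) :
    @IsOpen (Ultrafilter ℕ) (@alexandroffTopology ℕ t) O ↔
      ∀ u : Ultrafilter ℕ, (∀ s : Set ℕ, s.Finite → s ∉ u) → u ∈ O := by
  simp only [← Ultrafilter.le_cofinite_iff_forall_finite_notMem]
  exact isOpen_alexandroffTopology_iff_of_cofinite ht hO
end

section
/- For every nonempty topological space X, the M(E)-formula A(□p ∨ □¬p) → (Ap ∨ A¬p) (for a fixed propositional letter p, where A abbreviates ¬E¬) is valid in X if and only if X is connected. Equivalently, X is connected iff for every subset P ⊆ X such that every point of X lies in interior P ∪ interior Pᶜ, either P = X or P = ∅. -/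
/-- Formulas of the language M(E): the basic modal language plus the global modality E. -/
inductive MEFormula : Type
  | top : MEFormula
  | prop : ℕ → MEFormula
  | and : MEFormula → MEFormula → MEFormula
  | neg : MEFormula → MEFormula
  | box : MEFormula → MEFormula
  | ex : MEFormula → MEFormula

namespace MEFormula

/-- Truth of an M(E)-formula at a point of a topological model. -/
def Holds {X : Type*} [TopologicalSpace X] (ν : ℕ → Set X) : MEFormula → X → Prop
  | .top, _ => True
  | .prop n, w => w ∈ ν n
  | .and φ ψ, w => Holds ν φ w ∧ Holds ν ψ w
  | .neg φ, w => ¬ Holds ν φ w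
  | .box φ, w => ∃ O : Set X, IsOpen O ∧ w ∈ O ∧ ∀ v ∈ O, Holds ν φ v
  | .ex φ, _ => ∃ v : X, Holds ν φ v

/-- Validity of an M(E)-formula in a topological space. -/
def Valid (X : Type*) [TopologicalSpace X] (φ : MEFormula) : Prop :=
  ∀ (ν : ℕ → Set X) (w : X), Holds ν φ w

/-- Material implication, as an abbreviation. -/
def impl (φ ψ : MEFormula) : MEFormula := .neg (.and φ (.neg ψ))

/-- Disjunction, as an abbreviation. -/
def or' (φ ψ : MEFormula) : MEFormula := .neg (.and (.neg φ) (.neg ψ))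

/-- The global box A, abbreviating ¬E¬. -/
def all (φ : MEFormula) : MEFormula := .neg (.ex (.neg φ))

end MEFormula

/-- Shehtman's connectedness axiom A(□p ∨ □¬p) → (Ap ∨ A¬p), with p = p₀. -/
def connectednessAxiom : MEFormula :=
  MEFormula.impl
    (MEFormula.all
      (MEFormula.or' (MEFormula.box (MEFormula.prop 0))
        (MEFormula.box (MEFormula.neg (MEFormula.prop 0)))))
    (MEFormula.or' (MEFormula.all (MEFormula.prop 0))
      (MEFormula.all (MEFormula.neg (MEFormula.prop 0))))

namespace MEFormula

variable {X : Type*} [TopologicalSpace X] (ν : ℕ → Set X) (φ ψ : MEFormula) (w : X)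

theorem holds_impl : Holds ν (impl φ ψ) w ↔ (Holds ν φ w → Holds ν ψ w) := by
  simp [impl, Holds]

theorem holds_or' : Holds ν (or' φ ψ) w ↔ Holds ν φ w ∨ Holds ν ψ w := by
  simp only [or', Holds]
  tauto

theorem holds_all : Holds ν (all φ) w ↔ ∀ v, Holds ν φ v := by
  simp [all, Holds]

theorem holds_box : Holds ν (box φ) w ↔ w ∈ interior {v | Holds ν φ v} := by
  simp only [Holds, mem_interior]
  exact ⟨fun ⟨O, hO, hw, h⟩ => ⟨O, h, hO, hw⟩, fun ⟨O, h, hO, hw⟩ => ⟨O, hO, hw, h⟩⟩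

end MEFormula

theorem holds_connectednessAxiom {X : Type*} [TopologicalSpace X] (ν : ℕ → Set X) (w : X) :
    MEFormula.Holds ν connectednessAxiom w ↔
      ((∀ x, x ∈ interior (ν 0) ∪ interior (ν 0)ᶜ) → ν 0 = Set.univ ∨ ν 0 = ∅) := by
  simp only [connectednessAxiom, MEFormula.holds_impl, MEFormula.holds_or', MEFormula.holds_all,
    MEFormula.holds_box, Set.eq_univ_iff_forall, Set.eq_empty_iff_forall_notMem]
  rfl

theorem valid_connectednessAxiom_iff (X : Type*) [TopologicalSpace X] [Nonempty X] :
    MEFormula.Valid X connectednessAxiom ↔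
      ∀ P : Set X, (∀ x, x ∈ interior P ∪ interior Pᶜ) → P = Set.univ ∨ P = ∅ := by
  simp only [MEFormula.Valid, holds_connectednessAxiom]
  exact ⟨fun h P => h (fun _ => P) (Classical.arbitrary X), fun h ν _ => h (ν 0)⟩

theorem isClopen_iff_forall_mem_interior_union {X : Type*} [TopologicalSpace X] {P : Set X} :
    IsClopen P ↔ ∀ x, x ∈ interior P ∪ interior Pᶜ := by
  constructor
  · intro h x
    rw [h.isOpen.interior_eq, h.compl.isOpen.interior_eq, Set.union_compl_self]
    trivial
  · intro h
    refine ⟨isOpen_compl_iff.mp ?_, ?_⟩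
    · exact subset_interior_iff_isOpen.mp fun x hx =>
        (h x).resolve_left fun hP => hx (interior_subset hP)
    · exact subset_interior_iff_isOpen.mp fun x hx =>
        (h x).resolve_right fun hP => interior_subset hP hx

theorem connectedSpace_iff_forall_mem_interior_union (X : Type*) [TopologicalSpace X]
    [Nonempty X] :
    ConnectedSpace X ↔
      ∀ P : Set X, (∀ x, x ∈ interior P ∪ interior Pᶜ) → P = Set.univ ∨ P = ∅ := by
  simp only [connectedSpace_iff_clopen, ← isClopen_iff_forall_mem_interior_union, or_comm]
  exact and_iff_right inferInstance

theorem statement19 (X : Type*) [TopologicalSpace X] [Nonempty X] :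
    (MEFormula.Valid X connectednessAxiom ↔ ConnectedSpace X) ∧
    (ConnectedSpace X ↔
      ∀ P : Set X, (∀ x : X, x ∈ interior P ∪ interior Pᶜ) →
        P = Set.univ ∨ P = ∅) := by
  have hX := connectedSpace_iff_forall_mem_interior_union X
  exact ⟨(valid_connectednessAxiom_iff X).trans hX.symm, hX⟩
end
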